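/- Let p, q ∈ (1, ∞) be conjugate exponents (1/p + 1/q = 1). Let ‖·‖ be a norm on ℝ^k with dual norm ‖y‖_* = sup_{‖x‖ ≤ 1} ⟨x, y⟩, and let h : ℝ^k → ℝ^k satisfy ⟨h(y), y⟩ = ‖y‖_* for all y and ‖h(y)‖ = 1 for all y ≠ 0. Let l : ℝ^k → ℝ be Lipschitz continuous and continuously differentiable. Let X_1, …, X_N ∈ ℝ^k, let μ = (1/N) Σ_{n=1}^N δ_{X_n}, and assume ((1/N) Σ_{n=1}^N ‖∇l(X_n)‖_*^q)^{1/q} > 0. Define V(δ) = sup { ∫ l dη : η a probability measure on ℝ^k with W_p(μ, η) ≤ δ } and the empirical robust value V^e(δ) = sup { (1/N) Σ_{n=1}^N l(X̂_n) : X̂_1, …, X̂_N ∈ ℝ^k with ((1/N) Σ_{n=1}^N ‖X_n − X̂_n‖^p)^{1/p} ≤ δ }. Then V(δ) = V^e(δ) + o(δ) as δ ↓ 0. -/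

import Mathlib

open MeasureTheory Filter
open scoped ENNReal NNReal

noncomputable section

/-- The standard inner product pairing on `ℝ^k`. -/
def pairing {k : ℕ} (x y : Fin k → ℝ) : ℝ := ∑ i, x i * y i

/-- `nrm` is a norm on `ℝ^k`. -/
structure IsNorm {k : ℕ} (nrm : (Fin k → ℝ) → ℝ) : Prop where
  triangle : ∀ x y, nrm (x + y) ≤ nrm x + nrm y
  smul : ∀ (c : ℝ) (x : Fin k → ℝ), nrm (c • x) = |c| * nrm x
  pos : ∀ x, x ≠ 0 → 0 < nrm x

/-- The dual norm `‖y‖_* = sup_{‖x‖ ≤ 1} ⟨x, y⟩`. -/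
def dualNorm {k : ℕ} (nrm : (Fin k → ℝ) → ℝ) (y : Fin k → ℝ) : ℝ :=
  sSup {r | ∃ x, nrm x ≤ 1 ∧ r = pairing x y}

/-- The gradient of `l : ℝ^k → ℝ` with respect to the standard basis. -/
def grad {k : ℕ} (l : (Fin k → ℝ) → ℝ) (x : Fin k → ℝ) : Fin k → ℝ :=
  fun i => fderiv ℝ l x (Pi.single i 1)

/-- The `p`-Wasserstein distance (with respect to the norm `nrm`), as an
infimum over all couplings of `μ` and `ν`. -/
def Wp {k : ℕ} (p : ℝ) (nrm : (Fin k → ℝ) → ℝ) (μ ν : Measure (Fin k → ℝ)) : ℝ≥0∞ :=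
  ⨅ (π : Measure ((Fin k → ℝ) × (Fin k → ℝ))) (_ : IsProbabilityMeasure π)
    (_ : π.map Prod.fst = μ) (_ : π.map Prod.snd = ν),
    (∫⁻ z, ENNReal.ofReal (nrm (z.1 - z.2) ^ p) ∂π) ^ (1 / p)

/-- The robust value `V(δ) = sup { ∫ l dη : W_p(μ, η) ≤ δ }`. -/
def Vrob {k : ℕ} (p : ℝ) (nrm : (Fin k → ℝ) → ℝ) (l : (Fin k → ℝ) → ℝ)
    (μ : Measure (Fin k → ℝ)) (δ : ℝ) : ℝ :=
  sSup {r | ∃ η : Measure (Fin k → ℝ), IsProbabilityMeasure η ∧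
    Wp p nrm μ η ≤ ENNReal.ofReal δ ∧ r = ∫ x, l x ∂η}

/-- The empirical robust value `V^e(δ)`: the supremum of the empirical averages of `l`
over all perturbed datasets within an empirical `p`-Wasserstein budget `δ`. -/
def Vemp {k : ℕ} (p : ℝ) (nrm : (Fin k → ℝ) → ℝ) (l : (Fin k → ℝ) → ℝ)
    (N : ℕ) (X : Fin N → Fin k → ℝ) (δ : ℝ) : ℝ :=
  sSup {r | ∃ Y : Fin N → Fin k → ℝ,
    ((1 / (N : ℝ)) * ∑ n, nrm (X n - Y n) ^ p) ^ (1 / p) ≤ δ ∧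
    r = (1 / (N : ℝ)) * ∑ n, l (Y n)}

/-- The finitely supported uniform measure has the expected lower integrals. -/
lemma lintegral_empirical {α : Type*} [MeasurableSpace α] {N : ℕ} (κ : Fin N → Measure α)
    (f : α → ℝ≥0∞) :
    ∫⁻ x, f x ∂((N : ℝ≥0∞)⁻¹ • ∑ n, κ n) = (N : ℝ≥0∞)⁻¹ * ∑ n, ∫⁻ x, f x ∂κ n := by
  rw [lintegral_smul_measure, lintegral_finsetSum_measure, smul_eq_mul]

lemma isProbabilityMeasure_empirical {α : Type*} [MeasurableSpace α] {N : ℕ} (hN : 0 < N)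
    (κ : Fin N → Measure α) [∀ n, IsProbabilityMeasure (κ n)] :
    IsProbabilityMeasure ((N : ℝ≥0∞)⁻¹ • ∑ n, κ n) := by
  constructor
  have := ENNReal.inv_mul_cancel (a := (N : ℝ≥0∞)) (by exact_mod_cast hN.ne') (by simp)
  simpa using this

namespace IsNorm

variable {k : ℕ} {nrm : (Fin k → ℝ) → ℝ}

lemma map_zero (hnrm : IsNorm nrm) : nrm 0 = 0 := by
  simpa using hnrm.smul 0 0

lemma nonneg (hnrm : IsNorm nrm) (x : Fin k → ℝ) : 0 ≤ nrm x := by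
  rcases eq_or_ne x 0 with rfl | hx
  · exact hnrm.map_zero.ge
  · exact (hnrm.pos x hx).le

lemma map_sub_rev (hnrm : IsNorm nrm) (x y : Fin k → ℝ) : nrm (x - y) = nrm (y - x) := by
  simpa using hnrm.smul (-1) (y - x)

lemma convexOn (hnrm : IsNorm nrm) : ConvexOn ℝ Set.univ nrm := by
  refine ⟨convex_univ, fun x _ y _ a b ha hb _ => ?_⟩
  have := hnrm.triangle (a • x) (b • y)
  rwa [hnrm.smul, hnrm.smul, abs_of_nonneg ha, abs_of_nonneg hb] at this

lemma continuous (hnrm : IsNorm nrm) : Continuous nrm :=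
  continuousOn_univ.1 (hnrm.convexOn.continuousOn isOpen_univ)

lemma exists_norm_le (hnrm : IsNorm nrm) : ∃ c : ℝ, 0 < c ∧ ∀ x, ‖x‖ ≤ c * nrm x := by
  rcases (Metric.sphere (0 : Fin k → ℝ) 1).eq_empty_or_nonempty with he | hne
  · refine ⟨1, one_pos, fun x => ?_⟩
    rcases eq_or_ne x 0 with rfl | hx
    · simp [hnrm.map_zero]
    · have : ‖x‖⁻¹ • x ∈ Metric.sphere (0 : Fin k → ℝ) 1 := by
        simp [norm_smul, hx]
      simp [he] at this
  · obtain ⟨z, hz, hmin⟩ := (isCompact_sphere (0 : Fin k → ℝ) 1).exists_isMinOn hne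
      hnrm.continuous.continuousOn
    have hz0 : z ≠ 0 := by
      rintro rfl
      simp at hz
    have hzpos := hnrm.pos z hz0
    refine ⟨(nrm z)⁻¹, inv_pos.2 hzpos, fun x => ?_⟩
    rcases eq_or_ne x 0 with rfl | hx
    · simp [hnrm.map_zero]
    · have hmem : ‖x‖⁻¹ • x ∈ Metric.sphere (0 : Fin k → ℝ) 1 := by
        simp [norm_smul, hx]
      have h1 : nrm z ≤ nrm (‖x‖⁻¹ • x) := hmin hmem
      have hx' : 0 < ‖x‖ := norm_pos_iff.2 hx
      rw [hnrm.smul, abs_of_pos (inv_pos.2 hx'), inv_mul_eq_div, le_div_iff₀ hx'] at h1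
      rw [inv_mul_eq_div, le_div_iff₀ hzpos]
      linarith

lemma convexOn_sub_rpow (hnrm : IsNorm nrm) {p : ℝ} (hp : 1 ≤ p) (x : Fin k → ℝ) :
    ConvexOn ℝ Set.univ fun y => nrm (x - y) ^ p := by
  refine ⟨convex_univ, fun y _ z _ a b ha hb hab => ?_⟩
  have h1 : x - (a • y + b • z) = a • (x - y) + b • (x - z) := by
    have : x = (a + b) • x := by rw [hab, one_smul]
    nth_rewrite 1 [this]
    module
  have h2 : nrm (x - (a • y + b • z)) ≤ a • nrm (x - y) + b • nrm (x - z) := by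
    rw [h1]
    exact hnrm.convexOn.2 trivial trivial ha hb hab
  calc nrm (x - (a • y + b • z)) ^ p ≤ (a • nrm (x - y) + b • nrm (x - z)) ^ p :=
        Real.rpow_le_rpow (hnrm.nonneg _) h2 (by linarith)
    _ ≤ _ := (convexOn_rpow hp).2 (hnrm.nonneg _) (hnrm.nonneg _) ha hb hab

end IsNorm

lemma le_add_mul_rpow {p s u : ℝ} (hp : 1 < p) (hs : 0 < s) (hu : 0 ≤ u) :
    u ≤ s + s ^ (1 - p) * u ^ p := by
  have h0 : 0 ≤ s ^ (1 - p) * u ^ p := by positivity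
  rcases le_total u s with h | h
  · linarith
  · have hupos : 0 < u := hs.trans_le h
    have h1 : u ^ (1 - p) ≤ s ^ (1 - p) :=
      Real.rpow_le_rpow_of_nonpos hs h (by linarith)
    have h2 : u ^ (1 - p) * u ^ p = u := by
      rw [← Real.rpow_add hupos]
      simp
    have h3 := mul_le_mul_of_nonneg_right h1 (Real.rpow_nonneg hu p)
    linarith

/-- The first-order remainder of a Lipschitz function that is differentiable at `x` is bounded by
an arbitrarily small multiple of the distance plus a multiple of its `p`-th power. -/
lemma exists_remainder_bound {k : ℕ} {p : ℝ} (hp : 1 < p)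
    {nrm : (Fin k → ℝ) → ℝ} (hnrm : IsNorm nrm) {l : (Fin k → ℝ) → ℝ} {K : ℝ≥0}
    (hlip : LipschitzWith K l) {x : Fin k → ℝ} (hdiff : DifferentiableAt ℝ l x)
    {ε : ℝ} (hε : 0 < ε) :
    ∃ C : ℝ, 0 ≤ C ∧ ∀ y, |l y - l x - fderiv ℝ l x (y - x)| ≤
      ε * nrm (x - y) + C * nrm (x - y) ^ p := by
  obtain ⟨c, hc, hcn⟩ := hnrm.exists_norm_le
  have hlo := hdiff.hasFDerivAt.isLittleO.def (div_pos hε hc)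
  obtain ⟨ρ, hρ, hball⟩ := Metric.eventually_nhds_iff.1 hlo
  have hr : 0 < ρ / c := div_pos hρ hc
  refine ⟨2 * K * c * (ρ / c) ^ (1 - p), by positivity, fun y => ?_⟩
  have hD := hnrm.nonneg (x - y)
  have hyx : ‖y - x‖ ≤ c * nrm (x - y) := by
    rw [hnrm.map_sub_rev]; exact hcn _
  rcases lt_or_ge (dist y x) ρ with hlt | hge
  · have h1 := hball hlt
    rw [Real.norm_eq_abs] at h1
    have h2 : ε / c * ‖y - x‖ ≤ ε * nrm (x - y) := by
      calc ε / c * ‖y - x‖ ≤ ε / c * (c * nrm (x - y)) := by gcongr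
        _ = _ := by field_simp
    have h3 : 0 ≤ 2 * K * c * (ρ / c) ^ (1 - p) * nrm (x - y) ^ p := by positivity
    linarith
  · rw [dist_eq_norm] at hge
    have hDr : ρ / c ≤ nrm (x - y) := by
      rw [div_le_iff₀ hc]; linarith
    have hDpos := hr.trans_le hDr
    have h1 : nrm (x - y) ≤ (ρ / c) ^ (1 - p) * nrm (x - y) ^ p := by
      calc nrm (x - y) = nrm (x - y) ^ (1 - p) * nrm (x - y) ^ p := by
            rw [← Real.rpow_add hDpos]; simp
        _ ≤ _ := by
          gcongr ?_ * _
          exact Real.rpow_le_rpow_of_nonpos hr hDr (by linarith)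
    have h2 : |l y - l x| ≤ K * ‖y - x‖ := by
      simpa [dist_eq_norm] using hlip.dist_le_mul y x
    have h3 : |fderiv ℝ l x (y - x)| ≤ K * ‖y - x‖ :=
      ((fderiv ℝ l x).le_opNorm _).trans (by
        gcongr; exact norm_fderiv_le_of_lipschitz ℝ hlip)
    calc |l y - l x - fderiv ℝ l x (y - x)| ≤ 2 * K * ‖y - x‖ := by
          linarith [abs_sub (l y - l x) (fderiv ℝ l x (y - x))]
      _ ≤ 2 * K * (c * nrm (x - y)) := by gcongr
      _ = 2 * K * c * nrm (x - y) := by ring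
      _ ≤ 2 * K * c * ((ρ / c) ^ (1 - p) * nrm (x - y) ^ p) := by gcongr
      _ = 2 * K * c * (ρ / c) ^ (1 - p) * nrm (x - y) ^ p := by ring
      _ ≤ _ := by
        have : 0 ≤ ε * nrm (x - y) := by positivity
        linarith

/-- A coupling of an empirical measure disintegrates along its atoms. -/
lemma exists_disintegration {k N : ℕ} {X : Fin N → Fin k → ℝ}
    (π : Measure ((Fin k → ℝ) × (Fin k → ℝ))) [IsProbabilityMeasure π]
    (hfst : π.map Prod.fst = (N : ℝ≥0∞)⁻¹ • ∑ n, Measure.dirac (X n)) :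
    ∃ κ : Fin N → Measure (Fin k → ℝ), (∀ n, IsProbabilityMeasure (κ n)) ∧
      ∀ F : (Fin k → ℝ) × (Fin k → ℝ) → ℝ≥0∞, Measurable F →
        ∫⁻ z, F z ∂π = (N : ℝ≥0∞)⁻¹ * ∑ n, ∫⁻ y, F (X n, y) ∂κ n := by
  refine ⟨fun n => π.condKernel (X n), fun n => inferInstance, fun F hF => ?_⟩
  conv_lhs => rw [← π.disintegrate π.condKernel]
  rw [Measure.lintegral_compProd hF, Measure.fst, hfst, lintegral_empirical]
  congr 1
  refine Finset.sum_congr rfl fun n _ => ?_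
  rw [lintegral_dirac]

/-- Replacing a probability measure by (a contraction of) its barycentre changes the integral of a
nearly affine function only slightly, and does not increase the transport cost from `x`. -/
lemma integral_le_apply_barycentre {k : ℕ} {p : ℝ} (hp : 1 < p)
    {nrm : (Fin k → ℝ) → ℝ} (hnrm : IsNorm nrm) {l : (Fin k → ℝ) → ℝ} (hl : Continuous l)
    {x : Fin k → ℝ} {L : (Fin k → ℝ) →L[ℝ] ℝ} {M : ℝ} (hM : 0 ≤ M) (hL : ∀ v, L v ≤ M * nrm v)
    {ε C : ℝ} (hε : 0 ≤ ε) (hC : 0 ≤ C)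
    (hR : ∀ y, |l y - l x - L (y - x)| ≤ ε * nrm (x - y) + C * nrm (x - y) ^ p)
    (κ : Measure (Fin k → ℝ)) [IsProbabilityMeasure κ]
    (hint : Integrable (fun y => nrm (x - y) ^ p) κ)
    {s t : ℝ} (hs : 0 < s) (ht0 : 0 ≤ t) (ht1 : t ≤ 1) :
    Integrable l κ ∧ ∃ z, nrm (x - z) ^ p ≤ t ^ p * ∫ y, nrm (x - y) ^ p ∂κ ∧
      ∫ y, l y ∂κ ≤ l z + (((1 - t) * M + 2 * ε) * (s + s ^ (1 - p) * ∫ y, nrm (x - y) ^ p ∂κ) +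
        2 * C * ∫ y, nrm (x - y) ^ p ∂κ) := by
  obtain ⟨c, hc, hcn⟩ := hnrm.exists_norm_le
  set a := ∫ y, nrm (x - y) ^ p ∂κ with ha
  have hcont : Continuous fun y => nrm (x - y) := hnrm.continuous.comp (by fun_prop)
  have hD0 : ∀ y, 0 ≤ nrm (x - y) := fun y => hnrm.nonneg _
  have hdom : Integrable (fun y => s + s ^ (1 - p) * nrm (x - y) ^ p) κ :=
    (integrable_const _).add (hint.const_mul _)
  have hdomval : ∫ y, (s + s ^ (1 - p) * nrm (x - y) ^ p) ∂κ = s + s ^ (1 - p) * a := by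
    rw [integral_add (integrable_const _) (hint.const_mul _), integral_const_mul]
    simp [ha]
  have hDint : Integrable (fun y => nrm (x - y)) κ := by
    refine hdom.mono' hcont.aestronglyMeasurable (ae_of_all _ fun y => ?_)
    rw [Real.norm_eq_abs, abs_of_nonneg (hD0 y)]
    exact le_add_mul_rpow hp hs (hD0 y)
  have hDle : ∫ y, nrm (x - y) ∂κ ≤ s + s ^ (1 - p) * a := by
    rw [← hdomval]
    exact integral_mono hDint hdom fun y => le_add_mul_rpow hp hs (hD0 y)
  have hyxint : Integrable (fun y => y - x) κ := by
    refine (hDint.const_mul c).mono' (by fun_prop) (ae_of_all _ fun y => ?_)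
    rw [hnrm.map_sub_rev]
    exact hcn _
  have hyint : Integrable (fun y => y) κ := by
    refine (hyxint.add (integrable_const x)).congr (ae_of_all _ fun y => ?_)
    simp
  set m := ∫ y, y ∂κ with hm
  have hma : nrm (x - m) ^ p ≤ a := by
    have hconv := hnrm.convexOn_sub_rpow hp.le x
    exact hconv.map_integral_le (hconv.continuousOn isOpen_univ) isClosed_univ
      (ae_of_all _ fun _ => trivial) hyint hint
  have hmx : ∫ y, (y - x) ∂κ = m - x := by
    rw [integral_sub hyint (integrable_const _)]
    simp [hm]
  have hLint : Integrable (fun y => L (y - x)) κ := L.integrable_comp hyxint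
  have hRint : Integrable (fun y => l y - l x - L (y - x)) κ := by
    refine ((hDint.const_mul ε).add (hint.const_mul C)).mono' ?_ (ae_of_all _ hR)
    exact Continuous.aestronglyMeasurable (by fun_prop)
  have hlint : Integrable l κ := by
    have := (hRint.add hLint).add (integrable_const (l x))
    refine this.congr (ae_of_all _ fun y => ?_)
    simp
  have hRle : ∫ y, (l y - l x - L (y - x)) ∂κ ≤ ε * (s + s ^ (1 - p) * a) + C * a := by
    calc ∫ y, (l y - l x - L (y - x)) ∂κ
        ≤ ∫ y, (ε * nrm (x - y) + C * nrm (x - y) ^ p) ∂κ :=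
          integral_mono hRint ((hDint.const_mul ε).add (hint.const_mul C))
            fun y => (le_abs_self _).trans (hR y)
      _ = ε * ∫ y, nrm (x - y) ∂κ + C * a := by
          rw [integral_add (hDint.const_mul ε) (hint.const_mul C), integral_const_mul,
            integral_const_mul]
      _ ≤ _ := by gcongr
  have hlval : ∫ y, l y ∂κ = ∫ y, (l y - l x - L (y - x)) ∂κ + l x + L (m - x) := by
    have h1 : Integrable (fun y => l y - l x) κ := hlint.sub (integrable_const _)
    rw [integral_sub h1 hLint, integral_sub hlint (integrable_const _),
      L.integral_comp_comm hyxint, hmx, integral_const]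
    simp only [probReal_univ, one_smul]
    ring
  set z := x + t • (m - x) with hz
  have hxz : nrm (x - z) = t * nrm (x - m) := by
    have h1 : x - z = t • (x - m) := by rw [hz]; module
    rw [h1, hnrm.smul, abs_of_nonneg ht0]
  refine ⟨hlint, z, ?_, ?_⟩
  · rw [hxz, Real.mul_rpow ht0 (hD0 m)]
    gcongr
  · have hzle : nrm (x - z) ≤ nrm (x - m) := by
      rw [hxz]
      exact mul_le_of_le_one_left (hD0 m) ht1
    have hmle : nrm (x - m) ≤ s + s ^ (1 - p) * a := by
      refine (le_add_mul_rpow hp hs (hD0 m)).trans ?_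
      gcongr
    have hzp : nrm (x - z) ^ p ≤ a :=
      (Real.rpow_le_rpow (hD0 z) hzle (by linarith)).trans hma
    have hRz : ε * nrm (x - z) + C * nrm (x - z) ^ p ≤ ε * (s + s ^ (1 - p) * a) + C * a := by
      gcongr
      exact hzle.trans hmle
    have hLz : L (z - x) = t * L (m - x) := by
      have : z - x = t • (m - x) := by rw [hz]; module
      rw [this, map_smul, smul_eq_mul]
    have hLm : (1 - t) * L (m - x) ≤ (1 - t) * (M * (s + s ^ (1 - p) * a)) := by
      have h1 : L (m - x) ≤ M * nrm (x - m) := by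
        rw [hnrm.map_sub_rev]; exact hL _
      have h2 : 0 ≤ 1 - t := by linarith
      have h3 : M * nrm (x - m) ≤ M * (s + s ^ (1 - p) * a) := by gcongr
      exact mul_le_mul_of_nonneg_left (h1.trans h3) h2
    have := (abs_le.1 (hR z)).1
    rw [hLz] at this
    linarith

/-- Every measure at transport cost at most `s` from the empirical measure is nearly dominated,
as far as the integral of `l` is concerned, by a perturbed data set with budget `t * s`. -/
lemma exists_perturbation {k N : ℕ} (hN : 0 < N) {p : ℝ} (hp : 1 < p)
    {nrm : (Fin k → ℝ) → ℝ} (hnrm : IsNorm nrm) {l : (Fin k → ℝ) → ℝ} (hl : Continuous l)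
    {X : Fin N → Fin k → ℝ} {L : Fin N → (Fin k → ℝ) →L[ℝ] ℝ} {M : ℝ} (hM : 0 ≤ M)
    (hL : ∀ n v, L n v ≤ M * nrm v) {ε C : ℝ} (hε : 0 ≤ ε) (hC : 0 ≤ C)
    (hR : ∀ n y, |l y - l (X n) - L n (y - X n)| ≤
      ε * nrm (X n - y) + C * nrm (X n - y) ^ p)
    {s t : ℝ} (hs : 0 < s) (ht0 : 0 ≤ t) (ht1 : t ≤ 1)
    {η : Measure (Fin k → ℝ)}
    (hW : Wp p nrm ((N : ℝ≥0∞)⁻¹ • ∑ n, Measure.dirac (X n)) η < ENNReal.ofReal s) :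
    ∃ Z : Fin N → Fin k → ℝ,
      ((1 / (N : ℝ)) * ∑ n, nrm (X n - Z n) ^ p) ^ (1 / p) ≤ t * s ∧
      ∫ x, l x ∂η ≤ (1 / (N : ℝ)) * ∑ n, l (Z n) +
        (((1 - t) * M + 2 * ε) * (2 * s) + 2 * C * s ^ p) := by
  have hp0 : 0 < p := by linarith
  have hN0 : (0 : ℝ) < N := by exact_mod_cast hN
  simp only [Wp, iInf_lt_iff] at hW
  obtain ⟨π, hπ, hfst, hsnd, hcost⟩ := hW
  have hcost' : ∫⁻ z, ENNReal.ofReal (nrm (z.1 - z.2) ^ p) ∂π < ENNReal.ofReal (s ^ p) := by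
    rw [← ENNReal.ofReal_rpow_of_pos hs]
    rwa [one_div, ENNReal.rpow_inv_lt_iff hp0] at hcost
  have hmeas : Measurable fun x => nrm x ^ p :=
    (hnrm.continuous.rpow_const fun _ => Or.inr hp0.le).measurable
  obtain ⟨κ, hκ, hdis⟩ := exists_disintegration π hfst
  have hη : η = (N : ℝ≥0∞)⁻¹ • ∑ n, κ n := by
    ext A hA
    have h1 := hdis ((Prod.snd ⁻¹' A).indicator 1)
      (measurable_one.indicator (measurable_snd hA))
    rw [lintegral_indicator_one (measurable_snd hA), ← Measure.map_apply measurable_snd hA,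
      hsnd] at h1
    rw [h1, Measure.smul_apply, Measure.finsetSum_apply, smul_eq_mul]
    congr 1
    refine Finset.sum_congr rfl fun n _ => ?_
    rw [← lintegral_indicator_one hA]
    rfl
  rw [hdis (fun z => ENNReal.ofReal (nrm (z.1 - z.2) ^ p))
    (hmeas.comp (measurable_fst.sub measurable_snd)).ennreal_ofReal] at hcost'
  have hmeasn : ∀ n, Measurable fun y => nrm (X n - y) ^ p := fun n =>
    hmeas.comp (measurable_const.sub measurable_id)
  have hnn : ∀ n y, 0 ≤ nrm (X n - y) ^ p := fun n y => Real.rpow_nonneg (hnrm.nonneg _) _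
  have hfin : ∀ n, ∫⁻ y, ENNReal.ofReal (nrm (X n - y) ^ p) ∂κ n ≠ ∞ := by
    have h1 : ∑ n, ∫⁻ y, ENNReal.ofReal (nrm (X n - y) ^ p) ∂κ n ≠ ∞ := fun htop => by
      rw [htop, ENNReal.mul_top (by simp)] at hcost'
      exact not_top_lt hcost'
    exact fun n => (ENNReal.sum_ne_top.1 h1) n (Finset.mem_univ n)
  have hint : ∀ n, Integrable (fun y => nrm (X n - y) ^ p) (κ n) := fun n =>
    (lintegral_ofReal_ne_top_iff_integrable (hmeasn n).aestronglyMeasurable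
      (ae_of_all _ (hnn n))).1 (hfin n)
  have havg : (1 / (N : ℝ)) * ∑ n, ∫ y, nrm (X n - y) ^ p ∂κ n ≤ s ^ p := by
    have h1 : ∀ n, ∫⁻ y, ENNReal.ofReal (nrm (X n - y) ^ p) ∂κ n =
        ENNReal.ofReal (∫ y, nrm (X n - y) ^ p ∂κ n) := fun n =>
      (ofReal_integral_eq_lintegral_ofReal (hint n) (ae_of_all _ (hnn n))).symm
    simp only [h1] at hcost'
    rw [← ENNReal.ofReal_sum_of_nonneg fun n _ => integral_nonneg (hnn n),
      ← ENNReal.ofReal_natCast, ← ENNReal.ofReal_inv_of_pos hN0,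
      ← ENNReal.ofReal_mul (by positivity)] at hcost'
    rw [one_div]
    exact ((ENNReal.ofReal_lt_ofReal_iff (by positivity)).1 hcost').le
  choose hlint Z hZcost hZ using fun n => integral_le_apply_barycentre hp hnrm hl hM (hL n)
    hε hC (hR n) (κ n) (hint n) hs ht0 ht1
  have hηint : ∫ x, l x ∂η = (1 / (N : ℝ)) * ∑ n, ∫ x, l x ∂κ n := by
    rw [hη, integral_smul_measure, integral_finsetSum_measure fun n _ => hlint n]
    simp
  refine ⟨Z, ?_, ?_⟩
  · have h1 : (1 / (N : ℝ)) * ∑ n, nrm (X n - Z n) ^ p ≤ (t * s) ^ p := by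
      calc (1 / (N : ℝ)) * ∑ n, nrm (X n - Z n) ^ p
          ≤ (1 / (N : ℝ)) * ∑ n, t ^ p * ∫ y, nrm (X n - y) ^ p ∂κ n := by
            gcongr with n
            exact hZcost n
        _ = t ^ p * ((1 / (N : ℝ)) * ∑ n, ∫ y, nrm (X n - y) ^ p ∂κ n) := by
            rw [← Finset.mul_sum]; ring
        _ ≤ t ^ p * s ^ p := by gcongr
        _ = (t * s) ^ p := (Real.mul_rpow ht0 hs.le).symm
    rw [one_div p, Real.rpow_inv_le_iff_of_pos _ (by positivity) hp0]
    · exact h1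
    · exact mul_nonneg (by positivity) (Finset.sum_nonneg fun n _ => hnn n _)
  · set A := (1 / (N : ℝ)) * ∑ n, ∫ y, nrm (X n - y) ^ p ∂κ n with hA
    have hB : 0 ≤ (1 - t) * M + 2 * ε := by
      have : 0 ≤ 1 - t := by linarith
      positivity
    have hsA : s + s ^ (1 - p) * A ≤ 2 * s := by
      have h1 : s ^ (1 - p) * A ≤ s ^ (1 - p) * s ^ p := by gcongr
      have h2 : s ^ (1 - p) * s ^ p = s := by
        rw [← Real.rpow_add hs]; simp
      linarith
    rw [hηint]
    calc (1 / (N : ℝ)) * ∑ n, ∫ x, l x ∂κ n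
        ≤ (1 / (N : ℝ)) * ∑ n, (l (Z n) + (((1 - t) * M + 2 * ε) *
            (s + s ^ (1 - p) * ∫ y, nrm (X n - y) ^ p ∂κ n) +
            2 * C * ∫ y, nrm (X n - y) ^ p ∂κ n)) := by
          gcongr with n
          exact hZ n
      _ = (1 / (N : ℝ)) * ∑ n, l (Z n) +
            (((1 - t) * M + 2 * ε) * (s + s ^ (1 - p) * A) + 2 * C * A) := by
          simp only [hA, Finset.sum_add_distrib, ← Finset.mul_sum, Finset.sum_const,
            Finset.card_univ, Fintype.card_fin, nsmul_eq_mul]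
          field_simp
      _ ≤ _ := by gcongr

/-- Moving the atoms of an empirical measure costs at most the empirical transport cost. -/
lemma Wp_empirical_le {k N : ℕ} (hN : 0 < N) {p : ℝ} (hp : 0 < p)
    {nrm : (Fin k → ℝ) → ℝ} (hnrm : IsNorm nrm) (X Y : Fin N → Fin k → ℝ) :
    Wp p nrm ((N : ℝ≥0∞)⁻¹ • ∑ n, Measure.dirac (X n))
      ((N : ℝ≥0∞)⁻¹ • ∑ n, Measure.dirac (Y n)) ≤
      ENNReal.ofReal (((1 / (N : ℝ)) * ∑ n, nrm (X n - Y n) ^ p) ^ (1 / p)) := by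
  have hN0 : (0 : ℝ) < N := by exact_mod_cast hN
  have hnn : ∀ n, 0 ≤ nrm (X n - Y n) ^ p := fun n => Real.rpow_nonneg (hnrm.nonneg _) _
  have hmap : ∀ f : (Fin k → ℝ) × (Fin k → ℝ) → (Fin k → ℝ), Measurable f →
      ((N : ℝ≥0∞)⁻¹ • ∑ n, Measure.dirac (X n, Y n)).map f =
        (N : ℝ≥0∞)⁻¹ • ∑ n, Measure.dirac (f (X n, Y n)) := fun f hf => by
    rw [Measure.map_smul, ← Measure.mapₗ_apply_of_measurable hf, map_sum]
    simp [Measure.mapₗ_apply_of_measurable hf, Measure.map_dirac' hf]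
  refine iInf_le_of_le ((N : ℝ≥0∞)⁻¹ • ∑ n, Measure.dirac (X n, Y n)) ?_
  refine iInf_le_of_le (isProbabilityMeasure_empirical hN _) ?_
  refine iInf_le_of_le (hmap _ measurable_fst) ?_
  refine iInf_le_of_le (hmap _ measurable_snd) (le_of_eq ?_)
  rw [lintegral_empirical]
  simp only [lintegral_dirac]
  rw [← ENNReal.ofReal_sum_of_nonneg fun n _ => hnn n, ← ENNReal.ofReal_natCast,
    ← ENNReal.ofReal_inv_of_pos hN0, ← ENNReal.ofReal_mul (by positivity), ← one_div (N : ℝ),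
    ENNReal.ofReal_rpow_of_nonneg _ (by positivity)]
  exact mul_nonneg (by positivity) (Finset.sum_nonneg fun n _ => hnn n)

lemma bddAbove_Vemp {k N : ℕ} (hN : 0 < N) {p : ℝ} (hp : 1 < p)
    {nrm : (Fin k → ℝ) → ℝ} (hnrm : IsNorm nrm) {l : (Fin k → ℝ) → ℝ} {K : ℝ≥0}
    (hlip : LipschitzWith K l) (X : Fin N → Fin k → ℝ) {δ : ℝ} (hδ : 0 < δ) :
    BddAbove {r | ∃ Y : Fin N → Fin k → ℝ,
      ((1 / (N : ℝ)) * ∑ n, nrm (X n - Y n) ^ p) ^ (1 / p) ≤ δ ∧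
      r = (1 / (N : ℝ)) * ∑ n, l (Y n)} := by
  obtain ⟨c, hc, hcn⟩ := hnrm.exists_norm_le
  have hN0 : (0 : ℝ) < N := by exact_mod_cast hN
  have hp0 : 0 < p := by linarith
  refine ⟨(1 / (N : ℝ)) * ∑ n, l (X n) + K * c * (δ + δ ^ (1 - p) * δ ^ p), ?_⟩
  rintro _ ⟨Y, hY, rfl⟩
  have hnn : ∀ n, 0 ≤ nrm (X n - Y n) ^ p := fun n => Real.rpow_nonneg (hnrm.nonneg _) _
  rw [one_div p, Real.rpow_inv_le_iff_of_pos
    (mul_nonneg (by positivity) (Finset.sum_nonneg fun n _ => hnn n)) hδ.le hp0] at hY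
  have hl : ∀ n, l (Y n) ≤ l (X n) + K * c * (δ + δ ^ (1 - p) * nrm (X n - Y n) ^ p) := by
    intro n
    have h1 : l (Y n) - l (X n) ≤ K * ‖X n - Y n‖ := by
      have := hlip.dist_le_mul (X n) (Y n)
      rw [Real.dist_eq, dist_eq_norm] at this
      linarith [(abs_le.1 this).1]
    have h2 : (K : ℝ) * ‖X n - Y n‖ ≤ K * (c * (δ + δ ^ (1 - p) * nrm (X n - Y n) ^ p)) := by
      gcongr
      refine (hcn _).trans ?_
      gcongr
      exact le_add_mul_rpow hp hδ (hnrm.nonneg _)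
    linarith
  calc (1 / (N : ℝ)) * ∑ n, l (Y n)
      ≤ (1 / (N : ℝ)) * ∑ n, (l (X n) +
          K * c * (δ + δ ^ (1 - p) * nrm (X n - Y n) ^ p)) := by
        gcongr with n
        exact hl n
    _ = (1 / (N : ℝ)) * ∑ n, l (X n) +
          K * c * (δ + δ ^ (1 - p) * ((1 / (N : ℝ)) * ∑ n, nrm (X n - Y n) ^ p)) := by
        simp only [Finset.sum_add_distrib, ← Finset.mul_sum, Finset.sum_const,
          Finset.card_univ, Fintype.card_fin, nsmul_eq_mul]
        field_simp
    _ ≤ _ := by gcongr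

/-- The gap between the robust value and the empirical robust value is nonnegative and bounded by
an arbitrarily small multiple of `δ` plus a multiple of `δ ^ p`. -/
lemma Vrob_sub_Vemp_bounds {k N : ℕ} (hN : 0 < N) {p : ℝ} (hp : 1 < p)
    {nrm : (Fin k → ℝ) → ℝ} (hnrm : IsNorm nrm) {l : (Fin k → ℝ) → ℝ} {K : ℝ≥0}
    (hlip : LipschitzWith K l) (hdiff : Differentiable ℝ l) (X : Fin N → Fin k → ℝ) :
    ∃ M : ℝ, 0 < M ∧ ∀ ε : ℝ, 0 < ε → ε ≤ 1 → ∃ C : ℝ, ∀ δ : ℝ, 0 < δ →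
      0 ≤ Vrob p nrm l ((N : ℝ≥0∞)⁻¹ • ∑ n, Measure.dirac (X n)) δ - Vemp p nrm l N X δ ∧
      Vrob p nrm l ((N : ℝ≥0∞)⁻¹ • ∑ n, Measure.dirac (X n)) δ - Vemp p nrm l N X δ ≤
        ε * M * δ + C * δ ^ p := by
  obtain ⟨c, hc, hcn⟩ := hnrm.exists_norm_le
  have hp0 : 0 < p := by linarith
  have hL : ∀ n v, fderiv ℝ l (X n) v ≤ K * c * nrm v := fun n v => by
    calc fderiv ℝ l (X n) v ≤ ‖fderiv ℝ l (X n) v‖ := Real.le_norm_self _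
      _ ≤ ‖fderiv ℝ l (X n)‖ * ‖v‖ := (fderiv ℝ l (X n)).le_opNorm v
      _ ≤ K * (c * nrm v) := by
        gcongr
        · exact norm_fderiv_le_of_lipschitz ℝ hlip
        · exact hcn v
      _ = _ := by ring
  refine ⟨4 * (K * c) + 8, by positivity, fun ε hε hε1 => ?_⟩
  choose C hC hR using fun n => exists_remainder_bound hp hnrm hlip (hdiff (X n)) hε
  have hCn : ∀ n, C n ≤ ∑ i, C i := fun n =>
    Finset.single_le_sum (fun i _ => hC i) (Finset.mem_univ n)
  have hC0 : 0 ≤ ∑ i, C i := Finset.sum_nonneg fun i _ => hC i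
  refine ⟨2 * (∑ n, C n) * 2 ^ p, fun δ hδ => ?_⟩
  have hbdd := bddAbove_Vemp hN hp hnrm hlip X hδ
  have hε' : 0 < 1 + ε := by linarith
  have hkey : ∀ r ∈ {r | ∃ η : Measure (Fin k → ℝ), IsProbabilityMeasure η ∧
      Wp p nrm ((N : ℝ≥0∞)⁻¹ • ∑ n, Measure.dirac (X n)) η ≤ ENNReal.ofReal δ ∧
      r = ∫ x, l x ∂η}, r ≤ Vemp p nrm l N X δ +
        (ε * (4 * (K * c) + 8) * δ + 2 * (∑ n, C n) * 2 ^ p * δ ^ p) := by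
    rintro _ ⟨η, -, hW, rfl⟩
    have hδs : δ < (1 + ε) * δ := by nlinarith
    have hs : 0 < (1 + ε) * δ := by positivity
    obtain ⟨Z, hZ, hle⟩ := exists_perturbation (t := (1 + ε)⁻¹) hN hp hnrm hlip.continuous
      (by positivity) hL hε.le hC0
      (fun n y => (hR n y).trans (by
        have := Real.rpow_nonneg (hnrm.nonneg (X n - y)) p
        gcongr
        exact hCn n)) hs (by positivity)
      (inv_le_one_of_one_le₀ (by linarith))
      (hW.trans_lt ((ENNReal.ofReal_lt_ofReal_iff hs).2 hδs))
    rw [inv_mul_cancel_left₀ hε'.ne'] at hZ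
    have hZV : (1 / (N : ℝ)) * ∑ n, l (Z n) ≤ Vemp p nrm l N X δ :=
      le_csSup hbdd ⟨Z, hZ, rfl⟩
    have ht : 1 - (1 + ε)⁻¹ ≤ ε := by
      have : 1 - (1 + ε)⁻¹ = ε / (1 + ε) := by field_simp; ring
      rw [this]
      exact div_le_self hε.le (by linarith)
    have hs2 : (1 + ε) * δ ≤ 2 * δ := by gcongr; linarith
    have h1 : ((1 - (1 + ε)⁻¹) * (K * c) + 2 * ε) * (2 * ((1 + ε) * δ)) ≤
        (ε * (K * c) + 2 * ε) * (2 * (2 * δ)) := by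
      gcongr
    have h2 : 2 * (∑ n, C n) * ((1 + ε) * δ) ^ p ≤ 2 * (∑ n, C n) * (2 ^ p * δ ^ p) := by
      rw [← Real.mul_rpow zero_le_two hδ.le]
      gcongr
    linarith
  have hsub : {r | ∃ Y : Fin N → Fin k → ℝ,
      ((1 / (N : ℝ)) * ∑ n, nrm (X n - Y n) ^ p) ^ (1 / p) ≤ δ ∧
      r = (1 / (N : ℝ)) * ∑ n, l (Y n)} ⊆
      {r | ∃ η : Measure (Fin k → ℝ), IsProbabilityMeasure η ∧
        Wp p nrm ((N : ℝ≥0∞)⁻¹ • ∑ n, Measure.dirac (X n)) η ≤ ENNReal.ofReal δ ∧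
        r = ∫ x, l x ∂η} := by
    rintro _ ⟨Y, hY, rfl⟩
    refine ⟨_, isProbabilityMeasure_empirical hN fun n => Measure.dirac (Y n),
      (Wp_empirical_le hN hp0 hnrm X Y).trans (ENNReal.ofReal_le_ofReal hY), ?_⟩
    rw [integral_smul_measure, integral_finsetSum_measure fun n _ =>
      integrable_dirac (by simp)]
    simp
  have hne : {r | ∃ Y : Fin N → Fin k → ℝ,
      ((1 / (N : ℝ)) * ∑ n, nrm (X n - Y n) ^ p) ^ (1 / p) ≤ δ ∧
      r = (1 / (N : ℝ)) * ∑ n, l (Y n)}.Nonempty := by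
    refine ⟨_, X, ?_, rfl⟩
    simp [hnrm.map_zero, Real.zero_rpow hp0.ne', Real.zero_rpow (inv_pos.2 hp0).ne', hδ.le]
  exact ⟨sub_nonneg.2 (csSup_le_csSup ⟨_, hkey⟩ hne hsub),
    sub_le_iff_le_add'.2 (csSup_le (hne.mono hsub) hkey)⟩

theorem stmt3 {k : ℕ} (p q : ℝ) (hp : 1 < p) (hq : 1 < q) (hpq : 1 / p + 1 / q = 1)
    (nrm : (Fin k → ℝ) → ℝ) (hnrm : IsNorm nrm)
    (h : (Fin k → ℝ) → (Fin k → ℝ))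
    (hdual : ∀ y, pairing (h y) y = dualNorm nrm y)
    (hunit : ∀ y, y ≠ 0 → nrm (h y) = 1)
    (l : (Fin k → ℝ) → ℝ) (hlip : ∃ K : ℝ≥0, LipschitzWith K l)
    (hsmooth : ContDiff ℝ 1 l)
    (N : ℕ) (hN : 0 < N) (X : Fin N → Fin k → ℝ)
    (μ : Measure (Fin k → ℝ))
    (hμ : μ = (N : ℝ≥0∞)⁻¹ • ∑ n, Measure.dirac (X n))
    (hΥpos : 0 < ((1 / (N : ℝ)) * ∑ n, dualNorm nrm (grad l (X n)) ^ q) ^ (1 / q)) :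
    Tendsto (fun δ : ℝ =>
        (Vrob p nrm l μ δ - Vemp p nrm l N X δ) / δ)
      (nhdsWithin 0 (Set.Ioi 0)) (nhds 0) := by
  obtain ⟨K, hK⟩ := hlip
  subst hμ
  obtain ⟨M, hM, hV⟩ := Vrob_sub_Vemp_bounds hN hp hnrm hK
    (hsmooth.differentiable one_ne_zero) X
  rw [Metric.tendsto_nhds]
  intro e he
  obtain ⟨C, hC⟩ := hV (min 1 (e / (2 * M))) (lt_min one_pos (by positivity)) (min_le_left _ _)
  have hlim : Tendsto (fun δ : ℝ => C * δ ^ (p - 1)) (nhdsWithin 0 (Set.Ioi 0)) (nhds 0) := by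
    have h1 : Tendsto (fun δ : ℝ => C * δ ^ (p - 1)) (nhds 0) (nhds (C * 0 ^ (p - 1))) :=
      ((Real.continuousAt_rpow_const 0 (p - 1) (Or.inr (by linarith))).tendsto).const_mul C
    rw [Real.zero_rpow (by linarith), mul_zero] at h1
    exact h1.mono_left nhdsWithin_le_nhds
  filter_upwards [hlim.eventually_lt_const (half_pos he), self_mem_nhdsWithin] with δ hδe hδ
  have hδ : 0 < δ := hδ
  obtain ⟨h0, h1⟩ := hC δ hδ
  rw [Real.dist_eq, sub_zero, abs_of_nonneg (div_nonneg h0 hδ.le), div_lt_iff₀ hδ]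
  have h2 : min 1 (e / (2 * M)) * M ≤ e / 2 := by
    calc min 1 (e / (2 * M)) * M ≤ e / (2 * M) * M := by gcongr; exact min_le_right _ _
      _ = e / 2 := by field_simp
  have h3 : δ ^ p = δ ^ (p - 1) * δ := by
    rw [← Real.rpow_add_one hδ.ne', sub_add_cancel]
  rw [h3, ← mul_assoc, ← add_mul] at h1
  refine h1.trans_lt ?_
  gcongr
  linarith
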